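/- The map [ξ] = [u + v·i₂] ↦ (u × v)/u² is a well-defined bijection from Q¹_𝔹* := {[ξ] ∈ Q¹_𝔹 : 𝒩(ξ) ≠ 0} onto the complex 2-sphere S²_ℂ := {ζ ∈ ℂ³ : ζ₁² + ζ₂² + ζ₃² = 1}. (Here, for [ξ] ∈ Q¹_𝔹* with ξ = u + v·i₂, u, v ∈ ℂ³, one has u² = v² = 𝒩(ξ)/2 ≠ 0 and ⟨u,v⟩_ℂ = 0, the value (u × v)/u² = (u × v)/v² is independent of the chosen representative ξ, and it lies in S²_ℂ.) -/

import Mathlib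

noncomputable section

/-- Bicomplex multiplication on `𝔹 = ℂ × ℂ`. -/
def bmul (q w : ℂ × ℂ) : ℂ × ℂ := (q.1 * w.1 - q.2 * w.2, q.1 * w.2 + q.2 * w.1)

/-- Complex (square) norm of a bicomplex number. -/
def bN (q : ℂ × ℂ) : ℂ := q.1 ^ 2 + q.2 ^ 2

/-- Complex-bilinear inner product on `ℂ³`. -/
def innC (u v : Fin 3 → ℂ) : ℂ := ∑ k, u k * v k

/-- The first complex part `u` of a bicomplex vector `ξ = u + v i₂ ∈ 𝔹³`. -/
def uPart (ξ : Fin 3 → ℂ × ℂ) : Fin 3 → ℂ := fun k => (ξ k).1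

/-- The second complex part `v` of a bicomplex vector `ξ = u + v i₂ ∈ 𝔹³`. -/
def vPart (ξ : Fin 3 → ℂ × ℂ) : Fin 3 → ℂ := fun k => (ξ k).2

/-- `CQ¹_𝔹*`: null bicomplex vectors avoiding the fattened origin with `𝒩(ξ) ≠ 0`. -/
def CQstar : Set (Fin 3 → ℂ × ℂ) :=
  {ξ | (¬ ∀ k, bN (ξ k) = 0) ∧ (∑ k, bmul (ξ k) (ξ k) = 0) ∧ (∑ k, bN (ξ k)) ≠ 0}

/-- The relation `ξ ∼ ξ'` iff `ξ' = λ·ξ` for some `λ ∈ 𝔹`. -/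
def bsrel (ξ ξ' : CQstar) : Prop :=
  ∃ lam : ℂ × ℂ, ∀ k, (ξ' : Fin 3 → ℂ × ℂ) k = bmul lam ((ξ : Fin 3 → ℂ × ℂ) k)

/-- `Q¹_𝔹* = {[ξ] ∈ Q¹_𝔹 : 𝒩(ξ) ≠ 0}`. -/
def Q1Bstar := Quot bsrel

/-- The complex 2-sphere `S²_ℂ ⊆ ℂ³`. -/
def S2C : Set (Fin 3 → ℂ) := {ζ | ∑ k, ζ k ^ 2 = 1}

open Matrix

lemma innC_comm (u v : Fin 3 → ℂ) : innC u v = innC v u :=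
  dotProduct_comm u v

/-- Lagrange's identity. -/
lemma innC_cross_self (u v : Fin 3 → ℂ) :
    innC (crossProduct u v) (crossProduct u v) = innC u u * innC v v - innC u v ^ 2 := by
  rw [sq]
  nth_rw 5 [innC_comm]
  exact cross_dot_cross u v u v

lemma bmul_self_sum (ξ : Fin 3 → ℂ × ℂ) :
    ∑ k, bmul (ξ k) (ξ k) =
      (innC (uPart ξ) (uPart ξ) - innC (vPart ξ) (vPart ξ), 2 * innC (uPart ξ) (vPart ξ)) := by
  ext <;> simp [bmul, innC, uPart, vPart, Fin.sum_univ_three] <;> ring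

lemma bN_sum (ξ : Fin 3 → ℂ × ℂ) :
    ∑ k, bN (ξ k) = innC (uPart ξ) (uPart ξ) + innC (vPart ξ) (vPart ξ) := by
  simp only [bN, innC, uPart, vPart, Fin.sum_univ_three]
  ring

/-- Membership in `CQstar` in terms of the two complex parts of a bicomplex vector. -/
lemma mem_CQstar_iff (ξ : Fin 3 → ℂ × ℂ) :
    ξ ∈ CQstar ↔ innC (uPart ξ) (uPart ξ) = innC (vPart ξ) (vPart ξ) ∧
      innC (uPart ξ) (uPart ξ) ≠ 0 ∧ innC (uPart ξ) (vPart ξ) = 0 := by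
  simp only [CQstar, Set.mem_ofPred_eq, bmul_self_sum, Prod.mk_eq_zero, sub_eq_zero]
  constructor
  · rintro ⟨-, ⟨huv, h0⟩, hN⟩
    refine ⟨huv, fun hu => hN ?_, by simpa using h0⟩
    rw [bN_sum, ← huv, hu, add_zero]
  · rintro ⟨huv, hu, h0⟩
    have hN : ∑ k, bN (ξ k) ≠ 0 := by
      rw [bN_sum, ← huv, ← two_mul]
      exact mul_ne_zero two_ne_zero hu
    exact ⟨fun h => hN (Finset.sum_eq_zero fun k _ => h k), ⟨huv, by simp [h0]⟩, hN⟩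

/-- The normalized cross product `(u × v) / u²` of the parts of `ξ = u + v i₂`. -/
def normalizedCross (ξ : Fin 3 → ℂ × ℂ) : Fin 3 → ℂ :=
  (innC (uPart ξ) (uPart ξ))⁻¹ • crossProduct (uPart ξ) (vPart ξ)

lemma mem_S2C_iff (ζ : Fin 3 → ℂ) : ζ ∈ S2C ↔ innC ζ ζ = 1 := by
  simp [S2C, innC, sq]

lemma normalizedCross_mem_S2C {ξ : Fin 3 → ℂ × ℂ} (h : ξ ∈ CQstar) :
    normalizedCross ξ ∈ S2C := by
  obtain ⟨huv, hu, h0⟩ := (mem_CQstar_iff ξ).1 h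
  have hsmul (c : ℂ) (w : Fin 3 → ℂ) : innC (c • w) (c • w) = c ^ 2 * innC w w := by
    simp only [innC, Fin.sum_univ_three, Pi.smul_apply, smul_eq_mul]
    ring
  rw [mem_S2C_iff, normalizedCross, hsmul, innC_cross_self, ← huv, h0]
  field_simp
  ring

lemma normalizedCross_eq_of_bsrel {ξ ξ' : CQstar} (h : bsrel ξ ξ') :
    normalizedCross (ξ : Fin 3 → ℂ × ℂ) = normalizedCross (ξ' : Fin 3 → ℂ × ℂ) := by
  obtain ⟨lam, hlam⟩ := h
  obtain ⟨huv, hu, h0⟩ := (mem_CQstar_iff _).1 ξ.2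
  obtain ⟨-, hu', -⟩ := (mem_CQstar_iff _).1 ξ'.2
  have hinn : innC (uPart ξ') (uPart ξ') = bN lam * innC (uPart ξ) (uPart ξ) := by
    have e : innC (uPart ξ') (uPart ξ') = lam.1 ^ 2 * innC (uPart ξ) (uPart ξ)
        - 2 * lam.1 * lam.2 * innC (uPart ξ) (vPart ξ)
        + lam.2 ^ 2 * innC (vPart ξ) (vPart ξ) := by
      simp only [innC, uPart, vPart, hlam, bmul, Fin.sum_univ_three]
      ring
    rw [e, ← huv, h0, bN]
    ring
  have hcross : crossProduct (uPart ξ') (vPart ξ') =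
      bN lam • crossProduct (uPart ξ) (vPart ξ) := by
    ext k
    fin_cases k <;> simp [cross_apply, uPart, vPart, hlam, bmul, bN] <;> ring
  have hlam0 : bN lam ≠ 0 := fun h => hu' (by rw [hinn, h, zero_mul])
  rw [normalizedCross, normalizedCross, hinn, hcross, smul_smul]
  congr 1
  field_simp

/-- Both parts of a null bicomplex vector are recovered from each other by crossing with
the normalized cross product. -/
lemma cross_normalizedCross {ξ : Fin 3 → ℂ × ℂ} (h : ξ ∈ CQstar) :
    crossProduct (normalizedCross ξ) (uPart ξ) = vPart ξ ∧
      crossProduct (normalizedCross ξ) (vPart ξ) = -uPart ξ := by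
  obtain ⟨huv, hu, h0⟩ := (mem_CQstar_iff ξ).1 h
  have h1 (u v w : Fin 3 → ℂ) : crossProduct (crossProduct u v) w =
      innC u w • v - innC v w • u := cross_cross_eq_smul_sub_smul u v w
  have h0' : innC (vPart ξ) (uPart ξ) = 0 := by rw [innC_comm, h0]
  simp only [normalizedCross, map_smul, LinearMap.smul_apply, h1]
  rw [h0, h0', ← huv]
  constructor <;> simp [smul_smul, hu]

lemma bsrel_of_normalizedCross_eq {ξ ξ' : CQstar}
    (h : normalizedCross (ξ : Fin 3 → ℂ × ℂ) = normalizedCross (ξ' : Fin 3 → ℂ × ℂ)) :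
    bsrel ξ ξ' := by
  obtain ⟨hu, hv⟩ := cross_normalizedCross ξ.2
  obtain ⟨hu', hv'⟩ := cross_normalizedCross ξ'.2
  rw [← h] at hu' hv'
  set s := innC (uPart ξ) (uPart ξ)
  set a := s⁻¹ * innC (uPart ξ) (uPart ξ')
  set b := -(s⁻¹ * innC (vPart ξ) (uPart ξ'))
  have hV : vPart ξ' = a • vPart ξ + b • uPart ξ := by
    rw [← hu', normalizedCross, map_smul, LinearMap.smul_apply,
      cross_cross_eq_smul_sub_smul, smul_sub, smul_smul, smul_smul, sub_eq_add_neg, ← neg_smul]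
    rfl
  have hU : uPart ξ' = a • uPart ξ - b • vPart ξ := by
    rw [← neg_neg (uPart ξ'), ← hv', hV, map_add, map_smul, map_smul, hu, hv]
    simp [sub_eq_add_neg, add_comm]
  refine ⟨(a, b), fun k => Prod.ext ?_ ?_⟩
  · exact congrFun hU k
  · exact congrFun hV k

lemma exists_normalizedCross_eq {ζ : Fin 3 → ℂ} (hζ : ζ ∈ S2C) :
    ∃ ξ ∈ CQstar, normalizedCross ξ = ζ := by
  rw [mem_S2C_iff] at hζ
  obtain ⟨u, hu, hζu⟩ : ∃ u : Fin 3 → ℂ, innC u u ≠ 0 ∧ innC ζ u = 0 := by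
    obtain ⟨k, hk⟩ : ∃ k, 1 - ζ k ^ 2 ≠ 0 := by
      by_contra! hall
      simp only [innC, Fin.sum_univ_three] at hζ
      have : (2 : ℂ) = 0 := by linear_combination hall 0 + hall 1 + hall 2 + hζ
      exact two_ne_zero this
    have hinn (w : Fin 3 → ℂ) : innC w (Pi.single k 1 - ζ k • ζ) = w k - ζ k * innC w ζ := by
      change w ⬝ᵥ _ = _ - _ * w ⬝ᵥ ζ
      simp [dotProduct_sub]
    refine ⟨Pi.single k 1 - ζ k • ζ, ?_, by rw [hinn, hζ]; ring⟩
    rw [hinn, innC_comm _ ζ, hinn, hζ]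
    simpa [sq] using hk
  let ξ : Fin 3 → ℂ × ℂ := fun k => (u k, crossProduct ζ u k)
  have hU : uPart ξ = u := rfl
  have hV : vPart ξ = crossProduct ζ u := rfl
  refine ⟨ξ, (mem_CQstar_iff ξ).2 ?_, ?_⟩
  · rw [hU, hV, innC_cross_self, hζ, hζu]
    exact ⟨by ring, hu, dot_cross_self ζ u⟩
  · have : crossProduct u (crossProduct ζ u) = innC u u • ζ - innC ζ u • u :=
      cross_cross_eq_smul_sub_smul' u ζ u
    rw [normalizedCross, hU, hV, this, hζu, zero_smul, sub_zero, smul_smul, inv_mul_cancel₀ hu,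
      one_smul]

/-- `[ξ] = [u + v i₂] ↦ (u × v)/u²` is a well-defined bijection from
`Q¹_𝔹*` onto the complex 2-sphere `S²_ℂ`; here for `ξ ∈ CQ¹_𝔹*` one has
`u² = v² = 𝒩(ξ)/2 ≠ 0` and `⟨u,v⟩_ℂ = 0`. -/
theorem Q1Bstar_equiv_S2C :
    (∀ ξ ∈ CQstar,
      innC (uPart ξ) (uPart ξ) = innC (vPart ξ) (vPart ξ) ∧
      innC (uPart ξ) (uPart ξ) = (∑ k, bN (ξ k)) / 2 ∧
      innC (uPart ξ) (uPart ξ) ≠ 0 ∧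
      innC (uPart ξ) (vPart ξ) = 0) ∧
    ∃ F : Q1Bstar → S2C, Function.Bijective F ∧
      ∀ (ξ : Fin 3 → ℂ × ℂ) (h : ξ ∈ CQstar)
        (hm : (innC (uPart ξ) (uPart ξ))⁻¹ • crossProduct (uPart ξ) (vPart ξ) ∈ S2C),
        F (Quot.mk bsrel ⟨ξ, h⟩) =
          ⟨(innC (uPart ξ) (uPart ξ))⁻¹ • crossProduct (uPart ξ) (vPart ξ), hm⟩ := by
  refine ⟨fun ξ h => ?_, ?_⟩
  · obtain ⟨huv, hu, h0⟩ := (mem_CQstar_iff ξ).1 h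
    refine ⟨huv, ?_, hu, h0⟩
    rw [bN_sum, ← huv]
    ring
  · refine ⟨Quot.lift (fun ξ => ⟨normalizedCross ξ, normalizedCross_mem_S2C ξ.2⟩)
      fun ξ ξ' h => Subtype.ext (normalizedCross_eq_of_bsrel h), ⟨?_, ?_⟩, fun _ _ _ => rfl⟩
    · rintro ⟨ξ⟩ ⟨ξ'⟩ h
      exact Quot.sound (bsrel_of_normalizedCross_eq (congrArg Subtype.val h))
    · rintro ⟨ζ, hζ⟩
      obtain ⟨ξ, hξ, rfl⟩ := exists_normalizedCross_eq hζ
      exact ⟨Quot.mk _ ⟨ξ, hξ⟩, rfl⟩
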